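/- If {E_k} is a chain in Ω whose impression is the singleton {x} for some x ∈ ∂Ω, then x is accessible through {E_k}: there is a continuous curve γ : [0,1] → X with γ(1) = x, γ([0,1)) ⊆ Ω, and such that for every k there exists t_k ∈ (0,1) with γ([t_k,1)) ⊆ E_k. -/

import Mathlib

open Metric Set Filter Topology

/-- The distance between two subsets of a metric space
(infimum of pairwise distances, with `sInf ∅ = 0`). -/
noncomputable def setDist {X : Type*} [MetricSpace X] (A B : Set X) : ℝ :=
  sInf {d : ℝ | ∃ a ∈ A, ∃ b ∈ B, d = dist a b}

/-- `Ω` is a bounded domain: bounded, nonempty, open, connected, and not all of `X`. -/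
def BoundedDomain {X : Type*} [MetricSpace X] (Ω : Set X) : Prop :=
  IsOpen Ω ∧ IsConnected Ω ∧ Bornology.IsBounded Ω ∧ Ω ≠ Set.univ

/-- An acceptable set: a bounded connected set `E ⊊ Ω` whose closure meets `∂Ω`. -/
def Acceptable {X : Type*} [MetricSpace X] (Ω E : Set X) : Prop :=
  Bornology.IsBounded E ∧ IsConnected E ∧ E ⊆ Ω ∧ E ≠ Ω ∧
    (closure E ∩ frontier Ω).Nonempty

/-- A chain in `Ω`: a nested sequence of acceptable sets whose consecutive
relative boundaries are at positive distance and whose impression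
`⋂ k, closure (E k)` lies in `∂Ω`. -/
def IsChainIn {X : Type*} [MetricSpace X] (Ω : Set X) (E : ℕ → Set X) : Prop :=
  (∀ k, Acceptable Ω (E k)) ∧
  (∀ k, E (k + 1) ⊆ E k) ∧
  (∀ k, 0 < setDist (Ω ∩ frontier (E (k + 1))) (Ω ∩ frontier (E k))) ∧
  (⋂ k, closure (E k)) ⊆ frontier Ω

/-- A chain `E` divides a chain `F` if each `F k` contains some `E l`. -/
def Divides {X : Type*} (E F : ℕ → Set X) : Prop := ∀ k, ∃ l, E l ⊆ F k

/-- Two chains are equivalent if each divides the other. -/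
def EquivChains {X : Type*} (E F : ℕ → Set X) : Prop := Divides E F ∧ Divides F E

/-- A prime chain: a chain such that every chain dividing it is equivalent to it. -/
def IsPrimeChain {X : Type*} [MetricSpace X] (Ω : Set X) (E : ℕ → Set X) : Prop :=
  IsChainIn Ω E ∧ ∀ F : ℕ → Set X, IsChainIn Ω F → Divides F E → EquivChains F E

/-- A boundary point `x` is accessible if some curve in `Ω` ends at `x`. -/
def Accessible {X : Type*} [MetricSpace X] (Ω : Set X) (x : X) : Prop :=
  ∃ γ : ℝ → X, ContinuousOn γ (Set.Icc 0 1) ∧ γ 1 = x ∧ γ '' Set.Ico 0 1 ⊆ Ω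

/-- `Ω` is finitely connected at `x₀` if each ball around `x₀` contains an open
neighborhood `G` of `x₀` such that `G ∩ Ω` has finitely many components. -/
def FinitelyConnectedAt {X : Type*} [MetricSpace X] (Ω : Set X) (x₀ : X) : Prop :=
  ∀ r : ℝ, 0 < r → ∃ G : Set X, IsOpen G ∧ x₀ ∈ G ∧ G ⊆ Metric.ball x₀ r ∧
    {C : Set X | ∃ y ∈ G ∩ Ω, C = connectedComponentIn (G ∩ Ω) y}.Finite

open Relation

/-- A relation containing all pairs near the diagonal of a preconnected set generates all pairs. -/
theorem IsPreconnected.reflTransGen_of_eventually {X : Type*} [TopologicalSpace X] {V : Set X}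
    (hV : IsPreconnected V) {r : X → X → Prop} (hr : ∀ y ∈ V, ∀ᶠ z in 𝓝[V] y, r y z ∧ r z y)
    {a b : X} (ha : a ∈ V) (hb : b ∈ V) : ReflTransGen r a b :=
  hV.induction₂' (ReflTransGen r)
    (fun y hy => (hr y hy).mono fun _ h => ⟨.single h.1, .single h.2⟩)
    (fun _ _ _ _ _ _ => .trans) ha hb

theorem Relation.ReflTransGen.exists_seq {α : Type*} {r : α → α → Prop} {a b : α}
    (h : ReflTransGen r a b) :
    ∃ (n : ℕ) (c : ℕ → α), c 0 = a ∧ (∀ i, n ≤ i → c i = b) ∧ ∀ i < n, r (c i) (c (i + 1)) := by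
  induction h using ReflTransGen.head_induction_on with
  | refl => exact ⟨0, fun _ => b, rfl, fun _ _ => rfl, by simp⟩
  | @head a d had _ ih =>
    obtain ⟨n, c, h0, hn, hc⟩ := ih
    refine ⟨n + 1, fun i => Nat.casesOn i a c, rfl, ?_, ?_⟩
    · rintro (_ | i) hi
      · omega
      · exact hn i (by omega)
    · rintro (_ | i) hi
      · simpa [h0] using had
      · exact hc i (by omega)

/-- Consecutive points of the sequence `x`, which runs from `a` to `b` in `M` steps, lie in common
open connected subsets `V i` of `W` of diameter at most `ε`. -/
structure IsLinkChain {X : Type*} [MetricSpace X] (W : Set X) (a b : X) (ε : ℝ)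
    (M : ℕ) (x : ℕ → X) (V : ℕ → Set X) : Prop where
  pos : 0 < M
  zero : x 0 = a
  eq_of_le : ∀ i, M ≤ i → x i = b
  isOpen : ∀ i < M, IsOpen (V i)
  isPreconnected : ∀ i < M, IsPreconnected (V i)
  mem : ∀ i < M, x i ∈ V i
  succ_mem : ∀ i < M, x (i + 1) ∈ V i
  subset : ∀ i < M, V i ⊆ W
  dist_le : ∀ i < M, ∀ p ∈ V i, ∀ q ∈ V i, dist p q ≤ ε

namespace IsLinkChain

variable {X : Type*} [MetricSpace X] {W : Set X} {a b : X} {ε : ℝ} {M : ℕ} {x : ℕ → X}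
  {V : ℕ → Set X}

theorem nonneg (h : IsLinkChain W a b ε M x V) : 0 ≤ ε :=
  dist_nonneg.trans (h.dist_le 0 h.pos _ (h.mem 0 h.pos) _ (h.mem 0 h.pos))

theorem mem_set (h : IsLinkChain W a b ε M x V) (i : ℕ) : x i ∈ W := by
  rcases lt_or_ge i M with hi | hi
  · exact h.subset i hi (h.mem i hi)
  · have hM : M - 1 < M := by have := h.pos; omega
    have := h.subset _ hM (h.succ_mem _ hM)
    rwa [h.eq_of_le _ (by omega), ← h.eq_of_le i hi] at this

theorem dist_succ_le (h : IsLinkChain W a b ε M x V) (i : ℕ) : dist (x i) (x (i + 1)) ≤ ε := by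
  rcases lt_or_ge i M with hi | hi
  · exact h.dist_le i hi _ (h.mem i hi) _ (h.succ_mem i hi)
  · rw [h.eq_of_le i hi, h.eq_of_le (i + 1) (by omega), dist_self]
    exact h.nonneg

theorem _root_.IsPreconnected.exists_isLinkChain [LocallyConnectedSpace X] (hWo : IsOpen W)
    (hW : IsPreconnected W) (ha : a ∈ W) (hb : b ∈ W) {δ : ℝ} (hδ : 0 < δ) :
    ∃ M x V, IsLinkChain W a b δ M x V := by
  let r : X → X → Prop := fun y z => ∃ U ⊆ W, IsOpen U ∧ IsPreconnected U ∧ y ∈ U ∧ z ∈ U ∧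
    ∀ p ∈ U, ∀ q ∈ U, dist p q ≤ δ
  have hr : ∀ y ∈ W, ∀ᶠ z in 𝓝[W] y, r y z ∧ r z y := by
    intro y hy
    obtain ⟨U, hU, hUo, hyU, hUc⟩ := locallyConnectedSpace_iff_subsets_isOpen_isConnected.1 ‹_› y
      _ (inter_mem (hWo.mem_nhds hy) (ball_mem_nhds y (half_pos hδ)))
    refine mem_nhdsWithin_of_mem_nhds (mem_of_superset (hUo.mem_nhds hyU) fun z hz => ?_)
    have hd : ∀ p ∈ U, ∀ q ∈ U, dist p q ≤ δ := fun p hp q hq => by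
      have h1 := mem_ball.1 (hU hp).2
      have h2 := mem_ball.1 (hU hq).2
      linarith [dist_triangle_right p q y]
    exact ⟨⟨U, fun _ h => (hU h).1, hUo, hUc.isPreconnected, hyU, hz, hd⟩,
      ⟨U, fun _ h => (hU h).1, hUo, hUc.isPreconnected, hz, hyU, hd⟩⟩
  obtain ⟨n, c, h0, hn, hc⟩ := (hW.reflTransGen_of_eventually hr ha hb).exists_seq
  have hc' : ∀ i < n + 1, r (c i) (c (i + 1)) := by
    intro i hi
    rcases Nat.lt_succ_iff_lt_or_eq.1 hi with hi | rfl
    · exact hc i hi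
    · rw [hn i le_rfl, hn (i + 1) (by omega)]
      exact ((hr b hb).self_of_nhdsWithin hb).1
  choose! V hVW hVo hVc hm hm' hd using hc'
  exact ⟨n + 1, c, V, by omega, h0, fun i hi => hn i (by omega), hVo, hVc, hm, hm', hVW, hd⟩

theorem exists_of_le (h : IsLinkChain W a b ε M x V) {N : ℕ} (hN : M ≤ N) :
    ∃ U, IsLinkChain W a b ε N x U := by
  have hM := h.pos
  have key (i : ℕ) : min i (M - 1) < M := by omega
  have aux (i : ℕ) (hi : M - 1 < i) : x i ∈ V (M - 1) := by
    have := h.succ_mem (M - 1) (by omega)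
    rwa [h.eq_of_le _ (by omega), ← h.eq_of_le i (by omega)] at this
  refine ⟨fun i => V (min i (M - 1)), by omega, h.zero, fun i hi => h.eq_of_le i (by omega),
    fun i _ => h.isOpen _ (key i), fun i _ => h.isPreconnected _ (key i), fun i _ => ?_,
    fun i _ => ?_, fun i _ => h.subset _ (key i), fun i _ => h.dist_le _ (key i)⟩
  · rcases le_or_gt i (M - 1) with hi | hi
    · simpa only [min_eq_left hi] using h.mem i (by omega)
    · simpa only [min_eq_right hi.le] using aux i hi
  · rcases le_or_gt i (M - 1) with hi | hi
    · simpa only [min_eq_left hi] using h.succ_mem i (by omega)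
    · simpa only [min_eq_right hi.le] using aux (i + 1) (by omega)

theorem exists_refinement [LocallyConnectedSpace X] (h : IsLinkChain W a b ε M x V) {δ : ℝ}
    (hδ : 0 < δ) :
    ∃ (N : ℕ) (y : ℕ → X) (U : ℕ → Set X), IsLinkChain W a b δ (M * N) y U ∧
      ∀ j, dist (x (j / N)) (y j) ≤ ε := by
  have H : ∀ i < M, ∃ N y U, IsLinkChain (V i) (x i) (x (i + 1)) δ N y U := fun i hi =>
    (h.isPreconnected i hi).exists_isLinkChain (h.isOpen i hi) (h.mem i hi) (h.succ_mem i hi) hδ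
  have : Nonempty X := ⟨a⟩
  choose! N c U hc using H
  set L := (Finset.range M).sup N
  have hNL : ∀ i < M, N i ≤ L := fun i hi => Finset.le_sup (f := N) (Finset.mem_range.2 hi)
  choose! U' hU' using fun i hi => (hc i hi).exists_of_le (hNL i hi)
  have hLpos : 0 < L := (hc 0 h.pos).pos.trans_le (hNL 0 h.pos)
  have hlt {j : ℕ} (hj : j < M * L) : j / L < M := (Nat.div_lt_iff_lt_mul hLpos).2 hj
  have hmod (j : ℕ) : j % L < L := Nat.mod_lt j hLpos
  let y : ℕ → X := fun j => if j / L < M then c (j / L) (j % L) else b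
  have hy {j : ℕ} (hj : j / L < M) : y j = c (j / L) (j % L) := if_pos hj
  have hy' {j : ℕ} (hj : ¬ j / L < M) : y j = b := if_neg hj
  have hsucc {j : ℕ} (hj : j / L < M) : y (j + 1) = c (j / L) (j % L + 1) := by
    rcases Nat.lt_or_ge (j % L + 1) L with h1 | h1
    · have h2 : (j + 1) / L = j / L := by
        rw [Nat.div_eq_iff hLpos]
        have := Nat.div_add_mod' j L
        omega
      have h3 : (j + 1) % L = j % L + 1 := by
        rw [Nat.add_mod, Nat.mod_eq_of_lt (show 1 < L by omega), Nat.mod_eq_of_lt h1]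
      rw [hy (h2 ▸ hj), h2, h3]
    · have h1' : j % L + 1 = L := le_antisymm (hmod j) h1
      have hj1 : j + 1 = L * (j / L + 1) := by
        rw [mul_add, mul_one, ← Nat.div_add_mod j L, add_assoc, h1']
        simp [Nat.mul_add_div hLpos, Nat.div_eq_of_lt (hmod j)]
      have h2 : (j + 1) / L = j / L + 1 := by rw [hj1, Nat.mul_div_cancel_left _ hLpos]
      have h3 : (j + 1) % L = 0 := by rw [hj1, Nat.mul_mod_right]
      rw [h1', (hU' _ hj).eq_of_le L le_rfl]
      rcases Nat.lt_or_ge (j / L + 1) M with h4 | h4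
      · rw [hy (h2 ▸ h4), h2, h3, (hU' _ h4).zero]
      · rw [hy' (by omega), h.eq_of_le _ h4]
  refine ⟨L, y, fun j => U' (j / L) (j % L), ⟨Nat.mul_pos h.pos hLpos, ?_, fun j hj => ?_,
    fun j hj => ?_, fun j hj => ?_, fun j hj => ?_, fun j hj => ?_, fun j hj => ?_,
    fun j hj => ?_⟩, fun j => ?_⟩
  · rw [hy (by simpa using h.pos), Nat.zero_div, Nat.zero_mod, (hU' 0 h.pos).zero, h.zero]
  · exact hy' (not_lt.2 ((Nat.le_div_iff_mul_le hLpos).2 hj))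
  · exact (hU' _ (hlt hj)).isOpen _ (hmod j)
  · exact (hU' _ (hlt hj)).isPreconnected _ (hmod j)
  · rw [hy (hlt hj)]
    exact (hU' _ (hlt hj)).mem _ (hmod j)
  · rw [hsucc (hlt hj)]
    exact (hU' _ (hlt hj)).succ_mem _ (hmod j)
  · exact ((hU' _ (hlt hj)).subset _ (hmod j)).trans (h.subset _ (hlt hj))
  · exact (hU' _ (hlt hj)).dist_le _ (hmod j)
  · rcases lt_or_ge (j / L) M with hj | hj
    · rw [hy hj]
      exact h.dist_le _ hj _ (h.mem _ hj) _ ((hU' _ hj).mem_set _)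
    · rw [hy' hj.not_gt, h.eq_of_le _ hj, dist_self]
      exact h.nonneg

theorem joinedIn_closure [LocallyConnectedSpace X] [CompleteSpace X]
    (h : IsLinkChain W a b 1 M x V) : JoinedIn (closure W) a b := by
  let S (n : ℕ) := {p : ℕ × (ℕ → X) × (ℕ → Set X) //
    IsLinkChain W a b ((1 / 2 : ℝ) ^ n) p.1 p.2.1 p.2.2}
  have step (n : ℕ) (p : S n) : ∃ q : S (n + 1), ∃ N : ℕ, q.1.1 = p.1.1 * N ∧
      ∀ j, dist (p.1.2.1 (j / N)) (q.1.2.1 j) ≤ (1 / 2 : ℝ) ^ n := by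
    obtain ⟨N, y, U, hy, hd⟩ := p.2.exists_refinement (δ := (1 / 2 : ℝ) ^ (n + 1)) (by positivity)
    exact ⟨⟨(_, y, U), hy⟩, N, rfl, hd⟩
  choose next N hN hd using step
  let s (n : ℕ) : S n := Nat.rec ⟨(M, x, V), by simpa using h⟩ next n
  let m (n : ℕ) : ℕ := (s n).1.1
  let z (n : ℕ) : ℕ → X := (s n).1.2.1
  have hs (n : ℕ) : IsLinkChain W a b ((1 / 2 : ℝ) ^ n) (m n) (z n) (s n).1.2.2 := (s n).2
  let f (n : ℕ) (t : ℝ) : X := z n ⌊t * m n⌋₊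
  have hf (t : ℝ) (n : ℕ) : dist (f n t) (f (n + 1) t) ≤ 2 / 2 / 2 ^ n := by
    have hm : m (n + 1) = m n * N n (s n) := hN n (s n)
    have hNpos : 0 < N n (s n) := Nat.pos_of_mul_pos_left (hm ▸ (hs (n + 1)).pos)
    have : ⌊t * m (n + 1)⌋₊ / N n (s n) = ⌊t * m n⌋₊ := by
      rw [← Nat.floor_div_natCast, hm, Nat.cast_mul, ← mul_assoc, mul_div_cancel_right₀]
      positivity
    have h1 := hd n (s n) ⌊t * m (n + 1)⌋₊
    rw [this] at h1
    refine h1.trans_eq ?_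
    rw [div_self two_ne_zero, one_div_pow]
  choose γ hγ using fun t => cauchySeq_tendsto_of_complete (cauchySeq_of_le_geometric_two (hf t))
  have hfγ (t : ℝ) (n : ℕ) : dist (f n t) (γ t) ≤ 2 / 2 ^ n :=
    dist_le_of_le_geometric_two_of_tendsto (hf t) (hγ t) n
  have hfloor {u v : ℝ} (huv : u < v + 1) : ⌊u⌋₊ ≤ ⌊v⌋₊ + 1 := by
    refine Nat.lt_succ_iff.1 ((Nat.floor_lt' (Nat.succ_ne_zero _)).2 ?_)
    push_cast
    linarith [Nat.lt_floor_add_one v]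
  have hclose (n i j : ℕ) (hij : i ≤ j + 1) (hji : j ≤ i + 1) :
      dist (z n i) (z n j) ≤ 1 / 2 ^ n := by
    rw [← one_div_pow]
    obtain rfl | rfl | rfl : i = j ∨ i = j + 1 ∨ j = i + 1 := by omega
    · rw [dist_self]
      positivity
    · rw [dist_comm]
      exact (hs n).dist_succ_le j
    · exact (hs n).dist_succ_le i
  have hcont : Continuous γ := by
    refine Metric.continuous_iff.2 fun t ε hε => ?_
    obtain ⟨n, hn⟩ := exists_pow_lt_of_lt_one (show 0 < ε / 5 by positivity)
      (show (1 / 2 : ℝ) < 1 by norm_num)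
    have hmpos : (0 : ℝ) < m n := Nat.cast_pos.2 (hs n).pos
    refine ⟨1 / m n, by positivity, fun u hu => ?_⟩
    rw [Real.dist_eq, lt_div_iff₀ hmpos, ← Nat.abs_cast, ← abs_mul, sub_mul, abs_lt] at hu
    have h1 : dist (f n u) (f n t) ≤ 1 / 2 ^ n :=
      hclose n _ _ (hfloor (by linarith)) (hfloor (by linarith))
    have h2 := hfγ u n
    have h3 := hfγ t n
    have h4 : (2 : ℝ) / 2 ^ n = 2 * (1 / 2 ^ n) := by ring
    rw [one_div_pow] at hn
    rw [dist_comm] at h2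
    linarith [dist_triangle4 (γ u) (f n u) (f n t) (γ t)]
  refine JoinedIn.ofLine hcont.continuousOn ?_ ?_ ?_
  · refine tendsto_nhds_unique (hγ 0) (tendsto_const_nhds.congr fun n => ?_)
    simp [f, (hs n).zero]
  · refine tendsto_nhds_unique (hγ 1) (tendsto_const_nhds.congr fun n => ?_)
    simp [f, (hs n).eq_of_le]
  · rintro _ ⟨t, -, rfl⟩
    exact mem_closure_of_tendsto (hγ t) (.of_forall fun n => (hs n).mem_set _)

end IsLinkChain

/-- A complete locally connected metric space is locally path-connected. -/
theorem LocallyPathConnectedSpace.of_completeSpace {X : Type*} [MetricSpace X] [CompleteSpace X]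
    [LocallyConnectedSpace X] : LocallyPathConnectedSpace X := by
  refine locallyPathConnectedSpace_iff_pathComponentIn_mem_nhds.2 fun x u hu hxu => ?_
  obtain ⟨C, hC, hCc, hCu⟩ := exists_mem_nhds_isClosed_subset (hu.mem_nhds hxu)
  obtain ⟨W, hW, hWo, hxW, hWc⟩ := locallyConnectedSpace_iff_subsets_isOpen_isConnected.1 ‹_› x
    _ hC
  refine mem_of_superset (hWo.mem_nhds hxW) fun y hy => ?_
  obtain ⟨M, c, V, h⟩ := hWc.isPreconnected.exists_isLinkChain hWo hxW hy one_pos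
  exact h.joinedIn_closure.mono ((closure_minimal hW hCc).trans hCu)

/-- Countably many consecutive paths can be concatenated along a half-line. -/
theorem JoinedIn.exists_continuousOn_Ici {X : Type*} [TopologicalSpace X] {F : ℕ → Set X}
    {p : ℕ → X} (h : ∀ k, JoinedIn (F k) (p k) (p (k + 1))) :
    ∃ σ : ℝ → X, ContinuousOn σ (Ici 0) ∧ ∀ k : ℕ, ∀ s ∈ Icc (k : ℝ) (k + 1), σ s ∈ F k := by
  let q (k : ℕ) (s : ℝ) : X := (h k).somePath.extend (s - k)
  let σ (s : ℝ) : X := q ⌊s⌋₊ s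
  have hσ (k : ℕ) : EqOn σ (q k) (Icc k (k + 1)) := by
    rintro s ⟨hs, hs'⟩
    rcases hs'.lt_or_eq with hs' | rfl
    · have : ⌊s⌋₊ = k := (Nat.floor_eq_iff (k.cast_nonneg.trans hs)).2 ⟨hs, hs'⟩
      simp only [σ, this]
    · have : ⌊(k : ℝ) + 1⌋₊ = k + 1 := mod_cast Nat.floor_natCast (R := ℝ) (k + 1)
      simp [σ, q, this]
  have hfin : LocallyFinite fun k : ℕ => Icc (k : ℝ) (k + 1) :=
    (locallyFinite_Icc_of_tendsto (α := ℤ) (f := fun k => (k : ℝ)) (g := fun k => (k : ℝ) + 1)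
      tendsto_intCast_atTop_atTop
      (tendsto_atBot_add_const_right _ _ (tendsto_intCast_atBot_iff.2 tendsto_id))).comp_injective
      Nat.cast_injective
  refine ⟨σ, ?_, fun k s hs => ?_⟩
  · refine (hfin.continuousOn_iUnion (fun _ => isClosed_Icc) fun k => ?_).mono fun s hs =>
      mem_iUnion.2 ⟨⌊s⌋₊, Nat.floor_le hs, (Nat.lt_floor_add_one s).le⟩
    exact ContinuousOn.congr (by fun_prop) (hσ k)
  · rw [hσ k hs]
    exact (h k).somePath_mem _

section Chain

variable {X : Type*} [MetricSpace X] {Ω : Set X} {E : ℕ → Set X}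

theorem setDist_nonpos_of_mem {A B : Set X} {y : X} (hA : y ∈ A) (hB : y ∈ B) :
    setDist A B ≤ 0 :=
  csInf_le ⟨0, by rintro _ ⟨a, -, b, -, rfl⟩; exact dist_nonneg⟩ ⟨y, hA, y, hB, (dist_self y).symm⟩

namespace IsChainIn

theorem antitone (hE : IsChainIn Ω E) : Antitone E :=
  antitone_nat_of_succ_le hE.2.1

theorem succ_subset_interior (hE : IsChainIn Ω E) (k : ℕ) : E (k + 1) ⊆ interior (E k) := by
  intro y hy
  by_contra hyk
  have hyΩ : y ∈ Ω := (hE.1 (k + 1)).2.2.1 hy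
  have hfr : y ∈ frontier (E k) := ⟨subset_closure (hE.2.1 k hy), hyk⟩
  have hfr' : y ∈ frontier (E (k + 1)) :=
    ⟨subset_closure hy, fun h => hyk (interior_mono (hE.2.1 k) h)⟩
  exact (hE.2.2.1 k).not_ge (setDist_nonpos_of_mem ⟨hyΩ, hfr'⟩ ⟨hyΩ, hfr⟩)

theorem joinedIn [LocallyPathConnectedSpace X] (hE : IsChainIn Ω E) (k : ℕ) {y z : X}
    (hy : y ∈ E (k + 1)) (hz : z ∈ E (k + 1)) : JoinedIn (E k) y z := by
  have hsub := hE.succ_subset_interior k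
  have hG : IsPathConnected (connectedComponentIn (interior (E k)) y) :=
    (isOpen_interior.connectedComponentIn).isConnected_iff_isPathConnected.1
      (isConnected_connectedComponentIn_iff.2 (hsub hy))
  have hEG := (hE.1 (k + 1)).2.1.isPreconnected.subset_connectedComponentIn hy hsub
  exact (hG.joinedIn y (hEG hy) z (hEG hz)).mono
    ((connectedComponentIn_subset _ _).trans interior_subset)

theorem exists_subset_of_mem_nhds [ProperSpace X] (hE : IsChainIn Ω E) {x : X}
    (himp : ⋂ k, closure (E k) = {x}) {U : Set X} (hU : U ∈ 𝓝 x) : ∃ k, E k ⊆ U := by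
  obtain ⟨k, hk⟩ := exists_subset_nhds_of_isCompact (V := fun k => closure (E k))
    (Antitone.directed_ge fun _ _ h => closure_mono (hE.antitone h))
    (fun k => (hE.1 k).1.isCompact_closure) (U := U) (by rw [himp]; rintro _ rfl; exact hU)
  exact ⟨k, subset_closure.trans hk⟩

end IsChainIn

end Chain

/-- If the impression of a chain `E` is a singleton `{x}` with `x ∈ ∂Ω`,
then `x` is accessible through `E`. -/
theorem statement4 {X : Type*} [MetricSpace X] [ProperSpace X] [LocallyConnectedSpace X]
    (Ω : Set X) (hΩ : BoundedDomain Ω)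
    (E : ℕ → Set X) (hE : IsChainIn Ω E)
    (x : X) (hx : x ∈ frontier Ω) (himp : (⋂ k, closure (E k)) = {x}) :
    ∃ γ : ℝ → X, ContinuousOn γ (Set.Icc 0 1) ∧ γ 1 = x ∧
      γ '' Set.Ico 0 1 ⊆ Ω ∧
      ∀ k, ∃ t ∈ Set.Ioo (0 : ℝ) 1, γ '' Set.Ico t 1 ⊆ E k := by
  have := LocallyPathConnectedSpace.of_completeSpace (X := X)
  choose p hp using fun k => (hE.1 (k + 1)).2.1.nonempty
  obtain ⟨σ, hσ, hσE⟩ := JoinedIn.exists_continuousOn_Ici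
    fun k => hE.joinedIn k (hp k) (hE.2.1 _ (hp (k + 1)))
  have hmem (k : ℕ) (s : ℝ) (hs : (k : ℝ) ≤ s) : σ s ∈ E k :=
    hE.antitone (Nat.le_floor hs)
      (hσE _ s ⟨Nat.floor_le (k.cast_nonneg.trans hs), (Nat.lt_floor_add_one s).le⟩)
  let γ (t : ℝ) : X := if t < 1 then σ (t / (1 - t)) else x
  have hγ {t : ℝ} (ht : t < 1) : γ t = σ (t / (1 - t)) := if_pos ht
  have hγ1 : γ 1 = x := if_neg (lt_irrefl 1)
  have hγE (k : ℕ) (t : ℝ) (hkt : (k : ℝ) / (k + 1) ≤ t) (ht : t < 1) : γ t ∈ E k := by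
    rw [hγ ht]
    refine hmem k _ ?_
    rw [div_le_iff₀ (by positivity)] at hkt
    rw [le_div_iff₀ (by linarith)]
    linarith
  have hlt (k : ℕ) : (k : ℝ) / (k + 1) < 1 := (div_lt_one (by positivity)).2 (by linarith)
  refine ⟨γ, fun t ht => ?_, hγ1, ?_, fun k => ⟨(k + 1 : ℕ) / ((k + 1 : ℕ) + 1), ⟨by positivity,
    hlt _⟩, ?_⟩⟩
  · rcases ht.2.lt_or_eq with ht1 | rfl
    · have hmaps : MapsTo (fun t : ℝ => t / (1 - t)) (Ico 0 1) (Ici 0) :=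
        fun u hu => div_nonneg hu.1 (by linarith [hu.2])
      have hcont : ContinuousOn γ (Ico 0 1) :=
        (hσ.comp (continuousOn_id.div (by fun_prop) fun u hu => by linarith [hu.2]) hmaps).congr
          fun u hu => hγ hu.2
      refine (hcont t ⟨ht.1, ht1⟩).mono_of_mem_nhdsWithin ?_
      filter_upwards [self_mem_nhdsWithin, mem_nhdsWithin_of_mem_nhds (Iio_mem_nhds ht1)]
        with u hu hu1 using ⟨hu.1, hu1⟩
    · intro U hU
      rw [hγ1] at hU
      obtain ⟨k, hk⟩ := hE.exists_subset_of_mem_nhds himp hU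
      rw [mem_map]
      filter_upwards [self_mem_nhdsWithin, mem_nhdsWithin_of_mem_nhds (Ioi_mem_nhds (hlt k))]
        with u hu huk
      rcases hu.2.lt_or_eq with hu1 | rfl
      · exact hk (hγE k u (le_of_lt huk) hu1)
      · rw [mem_preimage, hγ1]
        exact mem_of_mem_nhds hU
  · rintro _ ⟨t, ht, rfl⟩
    exact (hE.1 0).2.2.1 (hγE 0 t (by simpa using ht.1) ht.2)
  · rintro _ ⟨t, ht, rfl⟩
    exact hE.2.1 k (hγE (k + 1) t ht.1 ht.2)
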